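/- Let 1 < p < ∞ and let ω ∈ A_p on ℝ^n. Then there exist constants c > 0 (depending only on n and p) such that for δ = c/(ω)_{A_p} one has ω^{1+δ} ∈ A_p with [ω^{1+δ}]_{A_p} ≤ 4 [ω]_{A_p}^{1+δ}, where (ω)_{A_p} = max([ω]_{B_∞}, [ω^{1−p'}]_{B_∞}). -/

import Mathlib

open MeasureTheory ENNReal Filter Set
open scoped ENNReal NNReal

noncomputable section

/-- Euclidean space ℝⁿ. -/
abbrev Euc (n : ℕ) := EuclideanSpace ℝ (Fin n)

/-- The axis-parallel cube with center `c` and half side-length `h`. -/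
def cube {n : ℕ} (c : Euc n) (h : ℝ) : Set (Euc n) := {x | ∀ i, |x i - c i| ≤ h}

/-- A weight: a locally integrable, a.e. positive function. -/
def IsWeight {n : ℕ} (w : Euc n → ℝ) : Prop :=
  LocallyIntegrable w volume ∧ ∀ᵐ x : Euc n ∂volume, 0 < w x

/-- Average of (the nonnegative part of) `w` over the cube `cube c h`, valued in `ℝ≥0∞`. -/
def eAvg {n : ℕ} (w : Euc n → ℝ) (c : Euc n) (h : ℝ) : ℝ≥0∞ :=
  (∫⁻ x in cube c h, ENNReal.ofReal (w x)) / volume (cube c h)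

/-- Conjugate exponent `p' = p/(p-1)`. -/
def conjExp (p : ℝ) : ℝ := p / (p - 1)

/-- The `A_p` ratio over a fixed cube. -/
def apRatio {n : ℕ} (p : ℝ) (w : Euc n → ℝ) (c : Euc n) (h : ℝ) : ℝ≥0∞ :=
  eAvg w c h * (eAvg (fun x => w x ^ (1 - conjExp p)) c h) ^ (p - 1)

/-- The Muckenhoupt `A_p` constant. -/
def apConst (n : ℕ) (p : ℝ) (w : Euc n → ℝ) : ℝ≥0∞ :=
  ⨆ (c : Euc n) (h : ℝ) (_ : 0 < h), apRatio p w c h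

/-- Hardy–Littlewood maximal function (over cubes), `ℝ≥0∞`-valued. -/
def hlMax {n : ℕ} (f : Euc n → ℝ) (x : Euc n) : ℝ≥0∞ :=
  ⨆ (c : Euc n) (h : ℝ) (_ : 0 < h) (_ : x ∈ cube c h),
    (∫⁻ y in cube c h, ENNReal.ofReal |f y|) / volume (cube c h)

/-- The Fujii–Wilson `B_∞` ratio over a fixed cube. -/
def bRatio {n : ℕ} (w : Euc n → ℝ) (c : Euc n) (h : ℝ) : ℝ≥0∞ :=
  (∫⁻ x in cube c h, hlMax ((cube c h).indicator w) x) /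
    (∫⁻ x in cube c h, ENNReal.ofReal (w x))

/-- The Fujii–Wilson `B_∞` constant. -/
def bConst (n : ℕ) (w : Euc n → ℝ) : ℝ≥0∞ :=
  ⨆ (c : Euc n) (h : ℝ) (_ : 0 < h), bRatio w c h

/-- The bilinear `A_{(2,2)}` ratio over a fixed cube. -/
def a22Ratio {n : ℕ} (w1 w2 : Euc n → ℝ) (c : Euc n) (h : ℝ) : ℝ≥0∞ :=
  eAvg (fun x => w1 x ^ ((1:ℝ)/2) * w2 x ^ ((1:ℝ)/2)) c h *
    ((eAvg (fun x => (w1 x)⁻¹) c h) ^ ((1:ℝ)/2) * (eAvg (fun x => (w2 x)⁻¹) c h) ^ ((1:ℝ)/2))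

/-- The bilinear `A_{(2,2)}` constant. -/
def a22Const (n : ℕ) (w1 w2 : Euc n → ℝ) : ℝ≥0∞ :=
  ⨆ (c : Euc n) (h : ℝ) (_ : 0 < h), a22Ratio w1 w2 c h

/-- Weighted `L²` norm, `ℝ≥0∞`-valued. -/
def wL2 {n : ℕ} (w f : Euc n → ℝ) : ℝ≥0∞ :=
  (∫⁻ x, ENNReal.ofReal (f x ^ 2 * w x)) ^ ((1:ℝ)/2)

/-- Weighted `L¹` norm, `ℝ≥0∞`-valued. -/
def wL1 {n : ℕ} (w f : Euc n → ℝ) : ℝ≥0∞ :=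
  ∫⁻ x, ENNReal.ofReal (|f x| * w x)

open scoped Topology

theorem mul_rpow_add_le_of_le_of_le_mul {a b K ε : ℝ≥0} (hba : b ≤ a) (haK : a ≤ K * b)
    (hε : ε ≤ 1) :
    a * a ^ (ε : ℝ) + K * ε * b ^ (1 + ε : ℝ) ≤ a * b ^ (ε : ℝ) + K * ε * a ^ (1 + ε : ℝ) := by
  rcases eq_or_ne b 0 with rfl | hb
  · have : a = 0 := by simpa using haK
    simp [this]
  have hb0 : 0 < (b : ℝ) := by positivity
  have hba' : (b : ℝ) ≤ a := by exact_mod_cast hba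
  have haK' : (a : ℝ) ≤ K * b := by exact_mod_cast haK
  have ha0 : 0 < (a : ℝ) := hb0.trans_le hba'
  have hε' : (ε : ℝ) ≤ 1 := by exact_mod_cast hε
  have hε0 : 0 ≤ (ε : ℝ) := ε.coe_nonneg
  have hbern : (a : ℝ) ^ (ε : ℝ) * b ≤ b ^ (ε : ℝ) * (b + ε * (a - b)) := by
    have h1 := rpow_one_add_le_one_add_mul_self (s := (a - b) / b)
      (by have : 0 ≤ ((a : ℝ) - b) / b := div_nonneg (by linarith) hb0.le
          linarith) hε0 hε'
    have h2 : (1 : ℝ) + (a - b) / b = a / b := by field_simp; ring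
    rw [h2, Real.div_rpow ha0.le hb0.le, div_le_iff₀ (by positivity)] at h1
    calc (a : ℝ) ^ (ε : ℝ) * b ≤ (1 + ε * ((a - b) / b)) * b ^ (ε : ℝ) * b := by gcongr
      _ = _ := by field_simp
  have hmono : (b : ℝ) ^ (ε : ℝ) ≤ a ^ (ε : ℝ) := by gcongr
  have key : (a : ℝ) * a ^ (ε : ℝ) + K * ε * b ^ (1 + ε : ℝ)
      ≤ a * b ^ (ε : ℝ) + K * ε * a ^ (1 + ε : ℝ) := by
    rw [Real.rpow_add ha0, Real.rpow_add hb0, Real.rpow_one, Real.rpow_one]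
    have h3 : ((a : ℝ) ^ (ε : ℝ) - b ^ (ε : ℝ)) * a ≤ (a ^ (ε : ℝ) - b ^ (ε : ℝ)) * (K * b) :=
      mul_le_mul_of_nonneg_left haK' (by linarith)
    have h4 : ((a : ℝ) ^ (ε : ℝ) - b ^ (ε : ℝ)) * b * K ≤ (b ^ (ε : ℝ) * (ε * (a - b))) * K :=
      mul_le_mul_of_nonneg_right (by linarith) K.2
    have h5 : K * ε * (a * (b : ℝ) ^ (ε : ℝ)) ≤ K * ε * (a * (a : ℝ) ^ (ε : ℝ)) := by gcongr
    linarith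
  exact_mod_cast key

theorem ENNReal.mul_rpow_add_le_of_le_of_le_mul {a b m U : ℝ≥0∞} {B K ε : ℝ≥0}
    (ha : a ≠ ∞) (hba : b ≤ a) (haK : a ≤ K * b) (hε : ε ≤ 1) (hU : U ≤ B * (a * m)) :
    U * a ^ (ε : ℝ) + (B * K * ε : ℝ≥0) * (b ^ (1 + ε : ℝ) * m)
      ≤ U * b ^ (ε : ℝ) + (B * K * ε : ℝ≥0) * (a ^ (1 + ε : ℝ) * m) := by
  have hb : b ≠ ∞ := ne_top_of_le_ne_top ha hba
  lift a to ℝ≥0 using ha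
  lift b to ℝ≥0 using hb
  have hba' : b ≤ a := by exact_mod_cast hba
  have h := _root_.mul_rpow_add_le_of_le_of_le_mul hba' (by exact_mod_cast haK) hε
  obtain ⟨d, hd⟩ := exists_add_of_le (show b ^ (ε : ℝ) ≤ a ^ (ε : ℝ) by gcongr)
  have h' : a * d + K * ε * b ^ (1 + ε : ℝ) ≤ K * ε * a ^ (1 + ε : ℝ) := by
    rw [hd, mul_add, add_assoc] at h
    exact le_of_add_le_add_left h
  rw [← ENNReal.coe_rpow_of_nonneg _ (by positivity),
    ← ENNReal.coe_rpow_of_nonneg _ (by positivity),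
    ← ENNReal.coe_rpow_of_nonneg _ (by positivity),
    ← ENNReal.coe_rpow_of_nonneg _ (by positivity), hd]
  have h'' : (a : ℝ≥0∞) * d + K * ε * (b ^ (1 + ε : ℝ) : ℝ≥0) ≤ K * ε * (a ^ (1 + ε : ℝ) : ℝ≥0) := by
    exact_mod_cast h'
  push_cast
  calc U * ((b ^ (ε : ℝ) : ℝ≥0) + d) + B * K * ε * ((b ^ (1 + ε : ℝ) : ℝ≥0) * m)
      = U * (b ^ (ε : ℝ) : ℝ≥0) + (U * d + B * K * ε * ((b ^ (1 + ε : ℝ) : ℝ≥0) * m)) := by ring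
    _ ≤ U * (b ^ (ε : ℝ) : ℝ≥0) +
        (B * (a * m) * d + B * K * ε * ((b ^ (1 + ε : ℝ) : ℝ≥0) * m)) := by gcongr
    _ = U * (b ^ (ε : ℝ) : ℝ≥0) + B * m * (a * d + K * ε * (b ^ (1 + ε : ℝ) : ℝ≥0)) := by ring
    _ ≤ U * (b ^ (ε : ℝ) : ℝ≥0) + B * m * (K * ε * (a ^ (1 + ε : ℝ) : ℝ≥0)) := by gcongr
    _ = _ := by ring

section Cells

variable {X ι : Type*}

/-- The cell of the `j`-th partition containing `x`, the partition being the fibres of `E j`. -/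
def cell (E : ℕ → X → ι) (j : ℕ) (x : X) : Set X := {y | E j y = E j x}

theorem mem_cell_self (E : ℕ → X → ι) (j : ℕ) (x : X) : x ∈ cell E j x := rfl

theorem cell_eq_of_mem {E : ℕ → X → ι} {j : ℕ} {x y : X} (h : y ∈ cell E j x) :
    cell E j y = cell E j x := by
  ext z
  simp only [cell, mem_ofPred_eq] at h ⊢
  rw [h]

/-- Each partition refines the preceding one. -/
def NestedCells (E : ℕ → X → ι) : Prop :=
  ∀ j x y, E (j + 1) y = E (j + 1) x → E j y = E j x

theorem NestedCells.cell_subset {E : ℕ → X → ι} (hE : NestedCells E) {i j : ℕ} (hij : i ≤ j)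
    (x : X) : cell E j x ⊆ cell E i x := by
  induction j, hij using Nat.le_induction with
  | base => exact subset_rfl
  | succ j _ ih => exact fun y hy => ih (hE j x y hy)

variable [MeasurableSpace X]

/-- The average of `g` over the cell of the `j`-th partition containing `x`. -/
def cellAvg (μ : Measure X) (E : ℕ → X → ι) (g : X → ℝ≥0∞) (j : ℕ) (x : X) : ℝ≥0∞ :=
  (∫⁻ y in cell E j x, g y ∂μ) / μ (cell E j x)

/-- The maximal function of `g` over the partitions of index at most `k`. -/
def cellMax (μ : Measure X) (E : ℕ → X → ι) (g : X → ℝ≥0∞) (k : ℕ) (x : X) : ℝ≥0∞ :=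
  partialSups (fun j => cellAvg μ E g j x) k

theorem cellMax_zero (μ : Measure X) (E : ℕ → X → ι) (g : X → ℝ≥0∞) (x : X) :
    cellMax μ E g 0 x = cellAvg μ E g 0 x := by
  simp [cellMax]

theorem cellMax_succ (μ : Measure X) (E : ℕ → X → ι) (g : X → ℝ≥0∞) (k : ℕ) (x : X) :
    cellMax μ E g (k + 1) x = max (cellMax μ E g k x) (cellAvg μ E g (k + 1) x) := by
  simp [cellMax, partialSups_add_one]

variable {μ : Measure X} {E : ℕ → X → ι} {g : X → ℝ≥0∞}

theorem cellAvg_le_cellMax {j k : ℕ} (hjk : j ≤ k) (x : X) :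
    cellAvg μ E g j x ≤ cellMax μ E g k x :=
  le_partialSups_of_le (fun j => cellAvg μ E g j x) hjk

theorem cellAvg_eq_of_mem {j : ℕ} {x y : X} (h : y ∈ cell E j x) :
    cellAvg μ E g j y = cellAvg μ E g j x := by
  rw [cellAvg, cell_eq_of_mem h, cellAvg]

theorem cellMax_eq_of_mem (hE : NestedCells E) {k : ℕ} {x y : X} (h : y ∈ cell E k x) :
    cellMax μ E g k y = cellMax μ E g k x := by
  induction k with
  | zero => rw [cellMax_zero, cellMax_zero, cellAvg_eq_of_mem h]
  | succ k ih =>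
    rw [cellMax_succ, cellMax_succ, ih (hE k x y h), cellAvg_eq_of_mem h]

theorem cellMax_le_max_iSup {j k : ℕ} (x : X) :
    cellMax μ E g k x ≤ max (cellMax μ E g j x) (⨆ i ≥ j, cellAvg μ E g i x) := by
  refine partialSups_le _ _ _ fun i _ => ?_
  rcases le_total i j with hij | hij
  · exact le_max_of_le_left (cellAvg_le_cellMax hij x)
  · exact le_max_of_le_right (le_iSup₂ (f := fun i (_ : i ≥ j) => cellAvg μ E g i x) i hij)

theorem setLIntegral_cell_eq [IsFiniteMeasure μ] (j : ℕ) (x : X) :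
    ∫⁻ y in cell E j x, g y ∂μ = cellAvg μ E g j x * μ (cell E j x) := by
  rw [cellAvg]
  by_cases h0 : μ (cell E j x) = 0
  · simp [h0, setLIntegral_measure_zero _ _ h0]
  · rw [ENNReal.div_mul_cancel h0 (measure_ne_top _ _)]

theorem cellAvg_ne_top (hg : ∫⁻ x, g x ∂μ ≠ ∞) (j : ℕ) (x : X) : cellAvg μ E g j x ≠ ∞ := by
  rw [cellAvg]
  by_cases h0 : μ (cell E j x) = 0
  · simp [h0, setLIntegral_measure_zero _ _ h0]
  · exact ENNReal.div_ne_top (ne_top_of_le_ne_top hg (setLIntegral_le_lintegral _ _)) h0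

theorem cellMax_ne_top (hg : ∫⁻ x, g x ∂μ ≠ ∞) (k : ℕ) (x : X) : cellMax μ E g k x ≠ ∞ := by
  induction k with
  | zero => rw [cellMax_zero]; exact cellAvg_ne_top hg 0 x
  | succ k ih =>
    rw [cellMax_succ]
    exact (max_lt ih.lt_top (cellAvg_ne_top hg _ x).lt_top).ne

theorem cellAvg_succ_le [IsFiniteMeasure μ] (hE : NestedCells E) {K : ℝ≥0} {j : ℕ} {x : X}
    (hK : μ (cell E j x) ≤ K * μ (cell E (j + 1) x)) :
    cellAvg μ E g (j + 1) x ≤ K * cellAvg μ E g j x := by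
  by_cases h0 : μ (cell E (j + 1) x) = 0
  · simp [cellAvg, h0, setLIntegral_measure_zero _ _ h0]
  · rw [cellAvg, ENNReal.div_le_iff h0 (measure_ne_top _ _)]
    calc ∫⁻ y in cell E (j + 1) x, g y ∂μ
        ≤ ∫⁻ y in cell E j x, g y ∂μ :=
          lintegral_mono_set (hE.cell_subset j.le_succ x)
      _ = cellAvg μ E g j x * μ (cell E j x) := setLIntegral_cell_eq j x
      _ ≤ cellAvg μ E g j x * (K * μ (cell E (j + 1) x)) := by gcongr
      _ = K * cellAvg μ E g j x * μ (cell E (j + 1) x) := by ring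

theorem cellMax_succ_le [IsFiniteMeasure μ] (hE : NestedCells E) {K : ℝ≥0} (hK1 : 1 ≤ K)
    {j : ℕ} {x : X} (hK : μ (cell E j x) ≤ K * μ (cell E (j + 1) x)) :
    cellMax μ E g (j + 1) x ≤ K * cellMax μ E g j x := by
  rw [cellMax_succ]
  refine max_le ?_ ((cellAvg_succ_le hE hK).trans ?_)
  · exact le_mul_of_one_le_left' (by exact_mod_cast hK1)
  · gcongr
    exact cellAvg_le_cellMax le_rfl x

theorem lintegral_cellMax_rpow_ne_top [IsFiniteMeasure μ]
    (hE : NestedCells E) {K : ℝ≥0} (hK1 : 1 ≤ K)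
    (hK : ∀ j x, μ (cell E j x) ≤ K * μ (cell E (j + 1) x)) {A : ℝ≥0∞} (hA : A ≠ ∞)
    (hA0 : ∀ᵐ x ∂μ, cellAvg μ E g 0 x = A) {q : ℝ} (hq : 0 ≤ q) (k : ℕ) :
    ∫⁻ x, cellMax μ E g k x ^ q ∂μ ≠ ∞ := by
  have hbound : ∀ x, cellMax μ E g k x ≤ K ^ k * cellAvg μ E g 0 x := by
    intro x
    induction k with
    | zero => simp [cellMax_zero]
    | succ k ih =>
      calc _ ≤ K * cellMax μ E g k x := cellMax_succ_le hE hK1 (hK k x)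
        _ ≤ K * (K ^ k * cellAvg μ E g 0 x) := by gcongr
        _ = _ := by ring
  have hle : ∫⁻ x, cellMax μ E g k x ^ q ∂μ ≤ ∫⁻ _, (K ^ k * A) ^ q ∂μ := by
    refine lintegral_mono_ae ?_
    filter_upwards [hA0] with x hx
    rw [← hx]
    exact ENNReal.rpow_le_rpow (hbound x) hq
  refine ne_top_of_le_ne_top ?_ hle
  rw [lintegral_const]
  exact ENNReal.mul_ne_top (ENNReal.rpow_ne_top_of_nonneg hq
    (ENNReal.mul_ne_top (by finiteness) hA)) (measure_ne_top _ _)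

variable [MeasurableSpace ι] [MeasurableSingletonClass ι]

theorem measurableSet_cell (hm : ∀ j, Measurable (E j)) (j : ℕ) (x : X) :
    MeasurableSet (cell E j x) :=
  hm j (measurableSet_singleton (E j x))

variable [Countable ι]

theorem measurable_cellAvg (hm : ∀ j, Measurable (E j)) (j : ℕ) :
    Measurable (cellAvg μ E g j) := by
  have : Measurable fun m : ι => (∫⁻ y in {y | E j y = m}, g y ∂μ) / μ {y | E j y = m} :=
    Measurable.of_discrete
  exact this.comp (hm j)

theorem measurable_cellMax (hm : ∀ j, Measurable (E j)) (k : ℕ) :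
    Measurable (cellMax μ E g k) := by
  induction k with
  | zero =>
    have : cellMax μ E g 0 = cellAvg μ E g 0 := funext (cellMax_zero μ E g)
    rw [this]
    exact measurable_cellAvg hm 0
  | succ k ih =>
    have : cellMax μ E g (k + 1) = fun x => max (cellMax μ E g k x) (cellAvg μ E g (k + 1) x) :=
      funext (cellMax_succ μ E g k)
    rw [this]
    exact ih.max (measurable_cellAvg hm _)

theorem lintegral_le_of_setLIntegral_cell_le (hm : ∀ j, Measurable (E j)) (j : ℕ)
    {φ ψ : X → ℝ≥0∞}
    (h : ∀ x, ∫⁻ y in cell E j x, φ y ∂μ ≤ ∫⁻ y in cell E j x, ψ y ∂μ) :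
    ∫⁻ y, φ y ∂μ ≤ ∫⁻ y, ψ y ∂μ := by
  have hU : ⋃ m, E j ⁻¹' {m} = univ := by
    ext x; simp
  have key : ∀ φ : X → ℝ≥0∞, ∫⁻ y, φ y ∂μ = ∑' m, ∫⁻ y in E j ⁻¹' {m}, φ y ∂μ := by
    intro φ
    rw [← lintegral_iUnion (fun m => hm j (measurableSet_singleton m)), hU,
      setLIntegral_univ]
    intro a b hab
    exact Disjoint.preimage _ (by simpa using hab)
  rw [key φ, key ψ]
  refine ENNReal.tsum_le_tsum fun m => ?_
  rcases (E j ⁻¹' {m}).eq_empty_or_nonempty with he | ⟨x, hx⟩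
  · simp [he]
  · obtain rfl : E j x = m := hx
    exact h x

theorem lintegral_mul_cellMax_succ_add_le [IsFiniteMeasure μ] (hm : ∀ j, Measurable (E j))
    (hE : NestedCells E) {K B ε : ℝ≥0} (hK1 : 1 ≤ K)
    (hK : ∀ j x, μ (cell E j x) ≤ K * μ (cell E (j + 1) x)) (hε : ε ≤ 1)
    (hg : ∫⁻ x, g x ∂μ ≠ ∞) {u : X → ℝ≥0∞} {j : ℕ}
    (hu : ∀ x, cellMax μ E g (j + 1) x = cellAvg μ E g (j + 1) x →
      ∫⁻ y in cell E (j + 1) x, u y ∂μ ≤ B * ∫⁻ y in cell E (j + 1) x, g y ∂μ) :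
    ∫⁻ x, u x * cellMax μ E g (j + 1) x ^ (ε : ℝ) ∂μ
        + (B * K * ε : ℝ≥0) * ∫⁻ x, cellMax μ E g j x ^ (1 + ε : ℝ) ∂μ
      ≤ ∫⁻ x, u x * cellMax μ E g j x ^ (ε : ℝ) ∂μ
        + (B * K * ε : ℝ≥0) * ∫⁻ x, cellMax μ E g (j + 1) x ^ (1 + ε : ℝ) ∂μ := by
  have hmeas : ∀ k, Measurable fun x =>
      ((B * K * ε : ℝ≥0) : ℝ≥0∞) * cellMax μ E g k x ^ (1 + ε : ℝ) := fun k =>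
    ((measurable_cellMax hm k).pow_const _).const_mul _
  rw [← lintegral_const_mul _ ((measurable_cellMax hm j).pow_const _),
    ← lintegral_const_mul _ ((measurable_cellMax hm (j + 1)).pow_const _),
    ← lintegral_add_right _ (hmeas j), ← lintegral_add_right _ (hmeas (j + 1))]
  refine lintegral_le_of_setLIntegral_cell_le hm (j + 1) fun x => ?_
  set P := cell E (j + 1) x with hP
  have hPm : MeasurableSet P := measurableSet_cell hm (j + 1) x
  set a := cellMax μ E g (j + 1) x with ha
  set b := cellMax μ E g j x with hb
  have ha_top : a ≠ ∞ := cellMax_ne_top hg _ x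
  have hb_top : b ≠ ∞ := cellMax_ne_top hg _ x
  have ha' : ∀ y ∈ P, cellMax μ E g (j + 1) y = a := fun y hy => cellMax_eq_of_mem hE hy
  have hb' : ∀ y ∈ P, cellMax μ E g j y = b := fun y hy =>
    cellMax_eq_of_mem hE (hE.cell_subset j.le_succ x hy)
  have key : ∀ s t : ℝ≥0∞, s ≠ ∞ → ∫⁻ y in P, (u y * s + (B * K * ε : ℝ≥0) * t) ∂μ
      = (∫⁻ y in P, u y ∂μ) * s + (B * K * ε : ℝ≥0) * (t * μ P) := by
    intro s t hs
    rw [lintegral_add_right _ measurable_const, lintegral_mul_const' _ _ hs, setLIntegral_const]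
    ring
  have hl : EqOn (fun y => u y * cellMax μ E g (j + 1) y ^ (ε : ℝ) +
      (B * K * ε : ℝ≥0) * cellMax μ E g j y ^ (1 + ε : ℝ))
      (fun y => u y * a ^ (ε : ℝ) + (B * K * ε : ℝ≥0) * b ^ (1 + ε : ℝ)) P :=
    fun y hy => by simp only [ha' y hy, hb' y hy]
  have hr : EqOn (fun y => u y * cellMax μ E g j y ^ (ε : ℝ) +
      (B * K * ε : ℝ≥0) * cellMax μ E g (j + 1) y ^ (1 + ε : ℝ))
      (fun y => u y * b ^ (ε : ℝ) + (B * K * ε : ℝ≥0) * a ^ (1 + ε : ℝ)) P :=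
    fun y hy => by simp only [ha' y hy, hb' y hy]
  rw [setLIntegral_congr_fun hPm hl, setLIntegral_congr_fun hPm hr,
    key _ _ (ENNReal.rpow_ne_top_of_nonneg ε.coe_nonneg ha_top),
    key _ _ (ENNReal.rpow_ne_top_of_nonneg ε.coe_nonneg hb_top)]
  have hba : b ≤ a := by rw [ha, cellMax_succ]; exact le_max_left _ _
  by_cases hab : a = b
  · rw [hab]
  have haf : a = cellAvg μ E g (j + 1) x := by
    rw [ha, cellMax_succ, max_eq_right_iff]
    by_contra! hlt
    exact hab (by rw [ha, cellMax_succ, max_eq_left hlt.le])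
  refine ENNReal.mul_rpow_add_le_of_le_of_le_mul ha_top hba (cellMax_succ_le hE hK1 (hK j x)) hε ?_
  rw [haf, ← setLIntegral_cell_eq]
  exact hu x haf

theorem lintegral_mul_cellMax_rpow_le [IsFiniteMeasure μ] (hm : ∀ j, Measurable (E j))
    (hE : NestedCells E) {K B ε : ℝ≥0} (hK1 : 1 ≤ K)
    (hK : ∀ j x, μ (cell E j x) ≤ K * μ (cell E (j + 1) x)) (hε : ε ≤ 1)
    (hg : ∫⁻ x, g x ∂μ ≠ ∞) {A : ℝ≥0∞} (hA : A ≠ ∞)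
    (hA0 : ∀ᵐ x ∂μ, cellAvg μ E g 0 x = A) {u : X → ℝ≥0∞} (k : ℕ)
    (hu : ∀ j < k, ∀ x, cellMax μ E g (j + 1) x = cellAvg μ E g (j + 1) x →
      ∫⁻ y in cell E (j + 1) x, u y ∂μ ≤ B * ∫⁻ y in cell E (j + 1) x, g y ∂μ) :
    ∫⁻ x, u x * cellMax μ E g k x ^ (ε : ℝ) ∂μ
      ≤ A ^ (ε : ℝ) * ∫⁻ x, u x ∂μ
        + (B * K * ε : ℝ≥0) * ∫⁻ x, cellMax μ E g k x ^ (1 + ε : ℝ) ∂μ := by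
  induction k with
  | zero =>
    refine le_add_right ?_
    rw [← lintegral_const_mul' _ _ (ENNReal.rpow_ne_top_of_nonneg ε.coe_nonneg hA)]
    refine lintegral_mono_ae ?_
    filter_upwards [hA0] with x hx
    rw [cellMax_zero, hx, mul_comm]
  | succ k ih =>
    have hfin : (B * K * ε : ℝ≥0) * ∫⁻ x, cellMax μ E g k x ^ (1 + ε : ℝ) ∂μ ≠ ∞ :=
      ENNReal.mul_ne_top ENNReal.coe_ne_top
        (lintegral_cellMax_rpow_ne_top hE hK1 hK hA hA0 (by positivity) k)
    refine (ENNReal.add_le_add_iff_right hfin).1 ?_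
    calc _ ≤ _ := lintegral_mul_cellMax_succ_add_le hm hE hK1 hK hε hg (hu k k.lt_succ_self)
      _ ≤ _ := add_le_add_left (ih fun j hj => hu j (hj.trans k.lt_succ_self)) _
      _ = _ := by ring

/-- A reverse Hölder inequality for functions whose maximal function over a nested sequence of
partitions satisfies a Fujii-Wilson condition on every cell. -/
theorem lintegral_rpow_one_add_le_of_cells [IsFiniteMeasure μ] (hm : ∀ j, Measurable (E j))
    (hE : NestedCells E) {K B ε : ℝ≥0} (hK1 : 1 ≤ K)
    (hK : ∀ j x, μ (cell E j x) ≤ K * μ (cell E (j + 1) x)) (hε0 : 0 < ε) (hε : ε ≤ 1)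
    (hBε : 2 * (B * K * ε) ≤ 1) (hgm : AEMeasurable g μ)
    (hg : ∫⁻ x, g x ∂μ ≠ ∞) {A : ℝ≥0∞} (hA : A ≠ ∞)
    (hA0 : ∀ᵐ x ∂μ, cellAvg μ E g 0 x = A)
    (hB : ∀ j x, ∫⁻ y in cell E j x, (⨆ i ≥ j, cellAvg μ E g i y) ∂μ
      ≤ B * ∫⁻ y in cell E j x, g y ∂μ)
    (hlim : ∀ᵐ x ∂μ, Tendsto (fun k => cellAvg μ E g k x) atTop (𝓝 (g x))) :
    ∫⁻ x, g x ^ (1 + ε : ℝ) ∂μ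
      ≤ (1 + 2 * (B * K * ε) : ℝ≥0) * (A ^ (ε : ℝ) * ∫⁻ x, g x ∂μ) := by
  have hbound : ∀ k, ∫⁻ x, g x * cellMax μ E g k x ^ (ε : ℝ) ∂μ
      ≤ (1 + 2 * (B * K * ε) : ℝ≥0) * (A ^ (ε : ℝ) * ∫⁻ x, g x ∂μ) := by
    intro k
    set Y := ∫⁻ x, cellMax μ E g k x ^ (1 + ε : ℝ) ∂μ with hY
    have hYtop : Y ≠ ∞ := lintegral_cellMax_rpow_ne_top hE hK1 hK hA hA0 (by positivity) k
    have hmax : ∫⁻ x, cellMax μ E g k x ∂μ ≤ B * ∫⁻ x, g x ∂μ := by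
      rw [← lintegral_const_mul' _ _ ENNReal.coe_ne_top]
      refine lintegral_le_of_setLIntegral_cell_le hm 0 fun x => ?_
      rw [lintegral_const_mul' _ _ ENNReal.coe_ne_top]
      refine le_trans (lintegral_mono fun y => ?_) (hB 0 x)
      refine (cellMax_le_max_iSup (j := 0) y).trans (max_le ?_ le_rfl)
      rw [cellMax_zero]
      exact le_iSup₂ (f := fun i (_ : i ≥ 0) => cellAvg μ E g i y) 0 le_rfl
    have hY1 : Y ≤ A ^ (ε : ℝ) * ∫⁻ x, cellMax μ E g k x ∂μ + (B * K * ε : ℝ≥0) * Y := by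
      refine le_trans (le_of_eq ?_) (lintegral_mul_cellMax_rpow_le hm hE hK1 hK hε hg hA hA0 k
        (u := cellMax μ E g k) fun j _ x hx => ?_)
      · refine lintegral_congr fun x => ?_
        rw [ENNReal.rpow_add_of_nonneg (1 : ℝ) (ε : ℝ) zero_le_one ε.coe_nonneg, ENNReal.rpow_one]
      · refine le_trans (setLIntegral_mono' (measurableSet_cell hm _ x) fun y hy => ?_)
          (hB (j + 1) x)
        refine (cellMax_le_max_iSup (j := j + 1) y).trans (max_le ?_ le_rfl)
        rw [cellMax_eq_of_mem hE hy, hx, ← cellAvg_eq_of_mem hy]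
        exact le_iSup₂ (f := fun i (_ : i ≥ j + 1) => cellAvg μ E g i y) (j + 1) le_rfl
    have hY2 : Y ≤ 2 * (B * (A ^ (ε : ℝ) * ∫⁻ x, g x ∂μ)) := by
      have hhalf : 2 * ((B * K * ε : ℝ≥0) * Y) ≤ Y := by
        rw [← mul_assoc]
        exact mul_le_of_le_one_left' (by exact_mod_cast hBε)
      have h2 : Y + Y ≤ 2 * (B * (A ^ (ε : ℝ) * ∫⁻ x, g x ∂μ)) + Y := by
        calc Y + Y = 2 * Y := by ring
          _ ≤ 2 * (A ^ (ε : ℝ) * (B * ∫⁻ x, g x ∂μ) + (B * K * ε : ℝ≥0) * Y) := by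
            gcongr; exact hY1.trans (by gcongr)
          _ = 2 * (B * (A ^ (ε : ℝ) * ∫⁻ x, g x ∂μ)) + 2 * ((B * K * ε : ℝ≥0) * Y) := by ring
          _ ≤ _ := by gcongr
      exact (ENNReal.add_le_add_iff_right hYtop).1 h2
    have h3 := lintegral_mul_cellMax_rpow_le hm hE hK1 hK hε hg hA hA0 k (B := 1) (u := g)
      fun j _ x _ => by simp
    calc _ ≤ _ := h3
      _ ≤ A ^ (ε : ℝ) * ∫⁻ x, g x ∂μ + (1 * K * ε : ℝ≥0) *
          (2 * (B * (A ^ (ε : ℝ) * ∫⁻ x, g x ∂μ))) := by gcongr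
      _ = _ := by push_cast; ring
  calc ∫⁻ x, g x ^ (1 + ε : ℝ) ∂μ
      ≤ ∫⁻ x, liminf (fun k => g x * cellMax μ E g k x ^ (ε : ℝ)) atTop ∂μ := by
        refine lintegral_mono_ae ?_
        filter_upwards [hlim] with x hx
        rw [ENNReal.rpow_add_of_nonneg (1 : ℝ) (ε : ℝ) zero_le_one ε.coe_nonneg, ENNReal.rpow_one]
        have hpow : Tendsto (fun k => cellAvg μ E g k x ^ (ε : ℝ)) atTop (𝓝 (g x ^ (ε : ℝ))) :=
          (ENNReal.continuous_rpow_const.tendsto _).comp hx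
        rcases eq_or_ne (g x) 0 with h0 | h0
        · simp [h0]
        have hlim' := ENNReal.Tendsto.const_mul (a := g x) hpow
          (Or.inl fun h => h0 (ENNReal.rpow_eq_zero_iff_of_pos hε0 |>.1 h))
        rw [← hlim'.liminf_eq]
        refine liminf_le_liminf (Eventually.of_forall fun k => ?_)
        gcongr
        exact cellAvg_le_cellMax le_rfl x
    _ ≤ liminf (fun k => ∫⁻ x, g x * cellMax μ E g k x ^ (ε : ℝ) ∂μ) atTop :=
        lintegral_liminf_le' fun k => hgm.mul ((measurable_cellMax hm k).pow_const _).aemeasurable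
    _ ≤ _ := liminf_le_of_le (by isBoundedDefault) fun b hb => by
        obtain ⟨k, hk⟩ := hb.exists
        exact hk.trans (hbound k)

end Cells

/-- The half-open cube with center `c` and half side-length `h`. -/
def halfOpenCube {n : ℕ} (c : Euc n) (h : ℝ) : Set (Euc n) :=
  {x | ∀ i, x i ∈ Ico (c i - h) (c i + h)}

theorem halfOpenCube_subset_cube {n : ℕ} (c : Euc n) (h : ℝ) : halfOpenCube c h ⊆ cube c h := by
  intro x hx i
  have := hx i
  rw [abs_le]
  constructor <;> linarith [this.1, this.2]

theorem cube_eq_preimage_closedBall {n : ℕ} (c : Euc n) {h : ℝ} (hh : 0 ≤ h) :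
    cube c h = (WithLp.ofLp : Euc n → Fin n → ℝ) ⁻¹' Metric.closedBall (WithLp.ofLp c) h := by
  ext x
  simp [cube, dist_pi_le_iff hh, Real.dist_eq]

theorem measurableSet_cube {n : ℕ} (c : Euc n) {h : ℝ} (hh : 0 ≤ h) :
    MeasurableSet (cube c h) := by
  rw [cube_eq_preimage_closedBall c hh]
  exact (PiLp.volume_preserving_ofLp (Fin n)).measurable Metric.isClosed_closedBall.measurableSet

theorem volume_cube {n : ℕ} (c : Euc n) {h : ℝ} (hh : 0 ≤ h) :
    volume (cube c h) = ENNReal.ofReal (2 * h) ^ n := by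
  rw [cube_eq_preimage_closedBall c hh,
    (PiLp.volume_preserving_ofLp (Fin n)).measure_preimage
      Metric.isClosed_closedBall.measurableSet.nullMeasurableSet,
    Real.volume_pi_closedBall _ hh, Fintype.card_fin, ENNReal.ofReal_pow (by positivity)]

theorem volume_cube_ne_zero {n : ℕ} (c : Euc n) {h : ℝ} (hh : 0 < h) :
    volume (cube c h) ≠ 0 := by
  rw [volume_cube c hh.le]
  exact pow_ne_zero _ (by simpa using hh)

theorem volume_cube_ne_top {n : ℕ} (c : Euc n) {h : ℝ} (hh : 0 ≤ h) :
    volume (cube c h) ≠ ∞ := by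
  rw [volume_cube c hh]
  finiteness

theorem halfOpenCube_eq_preimage {n : ℕ} (c : Euc n) (h : ℝ) :
    halfOpenCube c h = (WithLp.ofLp : Euc n → Fin n → ℝ) ⁻¹'
      (Set.pi univ fun i => Ico (c i - h) (c i + h)) := by
  ext x
  simp [halfOpenCube]

theorem measurableSet_halfOpenCube {n : ℕ} (c : Euc n) (h : ℝ) :
    MeasurableSet (halfOpenCube c h) := by
  rw [halfOpenCube_eq_preimage]
  exact (PiLp.volume_preserving_ofLp (Fin n)).measurable
    (MeasurableSet.univ_pi fun _ => measurableSet_Ico)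

theorem volume_halfOpenCube {n : ℕ} (c : Euc n) (h : ℝ) :
    volume (halfOpenCube c h) = ENNReal.ofReal (2 * h) ^ n := by
  rw [halfOpenCube_eq_preimage, (PiLp.volume_preserving_ofLp (Fin n)).measure_preimage
      (MeasurableSet.univ_pi fun _ => measurableSet_Ico).nullMeasurableSet, Real.volume_pi_Ico]
  have : ∀ i, c i + h - (c i - h) = 2 * h := fun i => by ring
  simp [this]

theorem halfOpenCube_ae_eq_cube {n : ℕ} (c : Euc n) {h : ℝ} (hh : 0 ≤ h) :
    halfOpenCube c h =ᵐ[volume] cube c h :=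
  ae_eq_of_subset_of_measure_ge (halfOpenCube_subset_cube c h)
    (by rw [volume_cube c hh, volume_halfOpenCube])
    (measurableSet_halfOpenCube c h).nullMeasurableSet (volume_cube_ne_top c hh)

/-- Lebesgue differentiation along cubes containing the point. -/
theorem ae_tendsto_setLIntegral_cube_div {n : ℕ} {f : Euc n → ℝ≥0∞} (hf : AEMeasurable f)
    (hfi : ∫⁻ x, f x ≠ ∞) :
    ∀ᵐ x : Euc n, ∀ (c : ℕ → Euc n) (r : ℕ → ℝ), Tendsto r atTop (𝓝[>] 0) →
      (∀ j, x ∈ cube (c j) (r j)) →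
      Tendsto (fun j => (∫⁻ y in cube (c j) (r j), f y) / volume (cube (c j) (r j))) atTop
        (𝓝 (f x)) := by
  have hto := PiLp.volume_preserving_toLp (Fin n)
  have hof := PiLp.volume_preserving_ofLp (Fin n)
  have hemb : MeasurableEmbedding (WithLp.ofLp : Euc n → Fin n → ℝ) :=
    (MeasurableEquiv.toLp 2 (Fin n → ℝ)).symm.measurableEmbedding
  have key := VitaliFamily.ae_tendsto_lintegral_div
    (IsUnifLocDoublingMeasure.vitaliFamily (volume : Measure (Fin n → ℝ)) 1)
    (f := fun z => f (WithLp.toLp 2 z))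
    (hf.comp_quasiMeasurePreserving hto.quasiMeasurePreserving)
    (by rwa [hto.lintegral_comp_emb (MeasurableEquiv.toLp 2 (Fin n → ℝ)).measurableEmbedding f])
  filter_upwards [hof.quasiMeasurePreserving.ae key] with x hx c r hr hxc
  have hball := IsUnifLocDoublingMeasure.tendsto_closedBall_filterAt
    (volume : Measure (Fin n → ℝ)) (K := 1) (x := WithLp.ofLp x) (fun j => WithLp.ofLp (c j)) r hr
    (by
      filter_upwards [hr self_mem_nhdsWithin] with j hj
      have h1 := hxc j
      rw [cube_eq_preimage_closedBall _ (le_of_lt hj)] at h1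
      simpa using h1)
  refine (hx.comp hball).congr' ?_
  filter_upwards [hr self_mem_nhdsWithin] with j hj
  simp only [Function.comp_apply]
  rw [cube_eq_preimage_closedBall _ (le_of_lt hj),
    hof.measure_preimage Metric.isClosed_closedBall.measurableSet.nullMeasurableSet,
    ← hof.setLIntegral_comp_preimage_emb hemb]

/-- The index, at generation `j`, of the dyadic descendant of the cube `cube c h` containing `x`. -/
def dyadicIndex {n : ℕ} (c : Euc n) (h : ℝ) (j : ℕ) (x : Euc n) : Fin n → ℤ :=
  fun i => ⌊2 ^ j * ((x i - (c i - h)) / (2 * h))⌋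

/-- The center of the dyadic descendant of generation `j` containing `x`. -/
def dyadicCenter {n : ℕ} (c : Euc n) (h : ℝ) (j : ℕ) (x : Euc n) : Euc n :=
  WithLp.toLp 2 fun i => c i - h + (2 * dyadicIndex c h j x i + 1) * (h / 2 ^ j)

theorem measurable_dyadicIndex {n : ℕ} (c : Euc n) (h : ℝ) (j : ℕ) :
    Measurable (dyadicIndex c h j) := by
  refine measurable_pi_iff.2 fun i => Int.measurable_floor.comp ?_
  fun_prop

theorem nestedCells_dyadicIndex {n : ℕ} (c : Euc n) (h : ℝ) : NestedCells (dyadicIndex c h) := by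
  have key : ∀ s t : ℝ, ⌊2 * s⌋ = ⌊2 * t⌋ → ⌊s⌋ ≤ ⌊t⌋ := by
    intro s t hst
    rw [Int.le_floor]
    have h1 : 2 * ⌊s⌋ ≤ ⌊2 * t⌋ := by
      rw [← hst, Int.le_floor]
      push_cast
      linarith [Int.floor_le s]
    have h2 : ((2 * ⌊s⌋ : ℤ) : ℝ) ≤ 2 * t := Int.le_floor.1 h1
    push_cast at h2
    linarith
  intro j x y hxy
  funext i
  have hi := congrFun hxy i
  simp only [dyadicIndex, pow_succ', mul_assoc] at hi ⊢
  exact le_antisymm (key _ _ hi) (key _ _ hi.symm)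

theorem cell_dyadicIndex {n : ℕ} (c : Euc n) {h : ℝ} (hh : 0 < h) (j : ℕ) (x : Euc n) :
    cell (dyadicIndex c h) j x = halfOpenCube (dyadicCenter c h j x) (h / 2 ^ j) := by
  ext y
  simp only [cell, mem_ofPred_eq, funext_iff, halfOpenCube]
  refine forall_congr' fun i => ?_
  simp only [dyadicCenter]
  generalize dyadicIndex c h j x i = m
  rw [dyadicIndex, Int.floor_eq_iff, mem_Ico]
  have e : 2 ^ j * ((y i - (c i - h)) / (2 * h)) = (y i - (c i - h)) / (2 * (h / 2 ^ j)) := by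
    field_simp
  have hr : 0 < 2 * (h / 2 ^ j) := by positivity
  rw [e, le_div_iff₀ hr, div_lt_iff₀ hr]
  constructor <;> rintro ⟨h1, h2⟩ <;> constructor <;> linarith

theorem dyadicCenter_zero_self {n : ℕ} (c : Euc n) {h : ℝ} (hh : 0 < h) :
    dyadicCenter c h 0 c = c := by
  ext i
  have e : ⌊h / (2 * h)⌋ = 0 := by
    have : h / (2 * h) = 1 / 2 := by field_simp
    rw [this]
    norm_num
  simp [dyadicCenter, dyadicIndex, e]

theorem halfOpenCube_eq_cell {n : ℕ} (c : Euc n) {h : ℝ} (hh : 0 < h) :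
    halfOpenCube c h = cell (dyadicIndex c h) 0 c := by
  rw [cell_dyadicIndex c hh, dyadicCenter_zero_self c hh, pow_zero, div_one]

theorem cell_dyadicIndex_subset {n : ℕ} {c x : Euc n} {h : ℝ} (hh : 0 < h)
    (hx : x ∈ halfOpenCube c h) (j : ℕ) :
    cell (dyadicIndex c h) j x ⊆ halfOpenCube c h := by
  rw [halfOpenCube_eq_cell c hh] at hx ⊢
  rw [← cell_eq_of_mem hx]
  exact (nestedCells_dyadicIndex c h).cell_subset j.zero_le x

theorem disjoint_cell_dyadicIndex {n : ℕ} {c x : Euc n} {h : ℝ} (hh : 0 < h)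
    (hx : x ∉ halfOpenCube c h) (j : ℕ) :
    Disjoint (cell (dyadicIndex c h) j x) (halfOpenCube c h) := by
  rw [halfOpenCube_eq_cell c hh] at hx ⊢
  rw [Set.disjoint_left]
  intro y hy hyc
  refine hx ?_
  rw [← cell_eq_of_mem hyc,
    cell_eq_of_mem ((nestedCells_dyadicIndex c h).cell_subset j.zero_le x hy)]
  exact mem_cell_self _ _ _

theorem measurableSet_cell_dyadicIndex {n : ℕ} (c : Euc n) (h : ℝ) (j : ℕ) (x : Euc n) :
    MeasurableSet (cell (dyadicIndex c h) j x) :=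
  measurableSet_cell (measurable_dyadicIndex c h) j x

theorem restrict_restrict_cell {n : ℕ} {c x : Euc n} {h : ℝ} (hh : 0 < h)
    (hx : x ∈ halfOpenCube c h) (j : ℕ) :
    (volume.restrict (halfOpenCube c h)).restrict (cell (dyadicIndex c h) j x)
      = volume.restrict (cube (dyadicCenter c h j x) (h / 2 ^ j)) := by
  rw [Measure.restrict_restrict_of_subset (cell_dyadicIndex_subset hh hx j),
    cell_dyadicIndex c hh]
  exact Measure.restrict_congr_set (halfOpenCube_ae_eq_cube _ (by positivity))

theorem restrict_cell_eq_zero {n : ℕ} {c x : Euc n} {h : ℝ} (hh : 0 < h)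
    (hx : x ∉ halfOpenCube c h) (j : ℕ) :
    volume.restrict (halfOpenCube c h) (cell (dyadicIndex c h) j x) = 0 := by
  rw [Measure.restrict_apply (measurableSet_cell_dyadicIndex c h j x),
    (disjoint_cell_dyadicIndex hh hx j).inter_eq, measure_empty]

theorem restrict_cell_eq_volume_cube {n : ℕ} {c x : Euc n} {h : ℝ} (hh : 0 < h)
    (hx : x ∈ halfOpenCube c h) (j : ℕ) :
    volume.restrict (halfOpenCube c h) (cell (dyadicIndex c h) j x)
      = volume (cube (dyadicCenter c h j x) (h / 2 ^ j)) := by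
  rw [← Measure.restrict_apply_univ, restrict_restrict_cell hh hx, Measure.restrict_apply_univ]

theorem restrict_cell_le {n : ℕ} {c : Euc n} {h : ℝ} (hh : 0 < h) (j : ℕ) (x : Euc n) :
    volume.restrict (halfOpenCube c h) (cell (dyadicIndex c h) j x)
      ≤ ((2 ^ n : ℝ≥0) : ℝ≥0∞) *
        volume.restrict (halfOpenCube c h) (cell (dyadicIndex c h) (j + 1) x) := by
  by_cases hx : x ∈ halfOpenCube c h
  · rw [restrict_cell_eq_volume_cube hh hx, restrict_cell_eq_volume_cube hh hx,
      volume_cube _ (by positivity), volume_cube _ (by positivity), ENNReal.coe_pow, ← mul_pow]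
    have e : 2 * (h / 2 ^ j) = 2 * (2 * (h / 2 ^ (j + 1))) := by
      rw [pow_succ]; field_simp
    rw [e, ENNReal.ofReal_mul zero_le_two]
    simp
  · rw [restrict_cell_eq_zero hh hx]
    exact zero_le

theorem cellAvg_dyadicIndex {n : ℕ} (v : Euc n → ℝ) {c x : Euc n} {h : ℝ} (hh : 0 < h)
    (hx : x ∈ halfOpenCube c h) (j : ℕ) :
    cellAvg (volume.restrict (halfOpenCube c h)) (dyadicIndex c h)
      (fun y => ENNReal.ofReal (v y)) j x = eAvg v (dyadicCenter c h j x) (h / 2 ^ j) := by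
  rw [cellAvg, restrict_restrict_cell hh hx, restrict_cell_eq_volume_cube hh hx, eAvg]

theorem mem_cube_dyadicCenter {n : ℕ} {c : Euc n} {h : ℝ} (hh : 0 < h) (j : ℕ) (x : Euc n) :
    x ∈ cube (dyadicCenter c h j x) (h / 2 ^ j) := by
  apply halfOpenCube_subset_cube
  rw [← cell_dyadicIndex c hh]
  exact mem_cell_self _ _ _

/-- The average of `v` over a cube is bounded by the maximal function of the localization of `v`
to another cube, when the former is contained in the latter up to a null set. -/
theorem eAvg_le_hlMax {n : ℕ} (v : Euc n → ℝ) {c c' x : Euc n} {r r' : ℝ} (hr : 0 < r)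
    (hx : x ∈ cube c r) (hsub : halfOpenCube c r ⊆ cube c' r') :
    eAvg v c r ≤ hlMax ((cube c' r').indicator v) x := by
  have h1 : eAvg v c r ≤
      (∫⁻ y in cube c r, ENNReal.ofReal |(cube c' r').indicator v y|) / volume (cube c r) := by
    rw [eAvg]
    gcongr ?_ / _
    rw [← setLIntegral_congr (halfOpenCube_ae_eq_cube c hr.le),
      ← setLIntegral_congr (halfOpenCube_ae_eq_cube c hr.le)]
    refine setLIntegral_mono' (measurableSet_halfOpenCube c r) fun y hy => ?_
    rw [indicator_of_mem (hsub hy)]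
    exact ENNReal.ofReal_le_ofReal (le_abs_self _)
  refine h1.trans ?_
  rw [hlMax]
  exact le_iSup_of_le c (le_iSup_of_le r (le_iSup_of_le hr (le_iSup_of_le hx le_rfl)))

theorem setLIntegral_ofReal_ne_zero {n : ℕ} {v : Euc n → ℝ} (hpos : ∀ᵐ x, 0 < v x)
    (hvm : AEMeasurable v) {c : Euc n} {h : ℝ} (hh : 0 < h) :
    ∫⁻ x in cube c h, ENNReal.ofReal (v x) ≠ 0 := by
  intro h0
  rw [lintegral_eq_zero_iff' hvm.ennreal_ofReal.restrict] at h0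
  have hfalse : ∀ᵐ _ ∂volume.restrict (cube c h), False := by
    filter_upwards [h0, ae_restrict_of_ae hpos] with x h1 h2
    simp only [Pi.zero_apply, ENNReal.ofReal_eq_zero] at h1
    linarith
  rw [eventually_false_iff_eq_bot, ae_eq_bot, Measure.restrict_eq_zero] at hfalse
  exact volume_cube_ne_zero c hh hfalse

theorem setLIntegral_hlMax_le {n : ℕ} {v : Euc n → ℝ} (hpos : ∀ᵐ x, 0 < v x) {c : Euc n} {h : ℝ}
    (hh : 0 < h) (hfin : ∫⁻ x in cube c h, ENNReal.ofReal (v x) ≠ ∞) (hvm : AEMeasurable v) :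
    ∫⁻ x in cube c h, hlMax ((cube c h).indicator v) x
      ≤ bConst n v * ∫⁻ x in cube c h, ENNReal.ofReal (v x) := by
  have h0 := setLIntegral_ofReal_ne_zero hpos hvm hh (c := c)
  rw [← ENNReal.div_le_iff h0 hfin]
  exact le_iSup_of_le c (le_iSup_of_le h (le_iSup_of_le hh le_rfl))

theorem one_le_bConst {n : ℕ} {v : Euc n → ℝ} (hpos : ∀ᵐ x, 0 < v x)
    (hfin : ∫⁻ x in cube (0 : Euc n) 1, ENNReal.ofReal (v x) ≠ ∞) (hvm : AEMeasurable v) :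
    1 ≤ bConst n v := by
  have h0 := setLIntegral_ofReal_ne_zero hpos hvm one_pos (c := 0)
  have hle : ∫⁻ x in cube (0 : Euc n) 1, ENNReal.ofReal (v x)
      ≤ ∫⁻ x in cube (0 : Euc n) 1, hlMax ((cube (0 : Euc n) 1).indicator v) x := by
    calc ∫⁻ x in cube (0 : Euc n) 1, ENNReal.ofReal (v x)
        = ∫⁻ _ in cube (0 : Euc n) 1, eAvg v 0 1 := by
          rw [setLIntegral_const, eAvg, ENNReal.div_mul_cancel (volume_cube_ne_zero _ one_pos)
            (volume_cube_ne_top _ zero_le_one)]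
      _ ≤ _ := setLIntegral_mono' (measurableSet_cube _ zero_le_one) fun x hx =>
          eAvg_le_hlMax v one_pos hx (halfOpenCube_subset_cube _ _)
  by_contra! hlt
  have h1 := hle.trans (setLIntegral_hlMax_le hpos one_pos hfin hvm)
  exact absurd h1 (not_le.2 (by
    simpa using ENNReal.mul_lt_mul_left h0 hfin hlt))

/-- The sharp reverse Hölder inequality for weights satisfying a Fujii-Wilson condition. -/
theorem eAvg_rpow_one_add_le {n : ℕ} {v : Euc n → ℝ} (hvm : AEMeasurable v)
    (hpos : ∀ᵐ x, 0 < v x)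
    (hfin : ∀ (c : Euc n) (h : ℝ), 0 < h → ∫⁻ x in cube c h, ENNReal.ofReal (v x) ≠ ∞)
    {B ε : ℝ≥0} (hB : bConst n v ≤ B) (hε0 : 0 < ε) (hε : ε ≤ 1)
    (hBε : 2 * (B * 2 ^ n * ε) ≤ 1) (c : Euc n) {h : ℝ} (hh : 0 < h) :
    eAvg (fun x => v x ^ (1 + ε : ℝ)) c h
      ≤ (1 + 2 * (B * 2 ^ n * ε) : ℝ≥0) * eAvg v c h ^ (1 + ε : ℝ) := by
  set g : Euc n → ℝ≥0∞ := fun x => ENNReal.ofReal (v x) with hg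
  have hgm : AEMeasurable g := hvm.ennreal_ofReal
  have hgQ : ∫⁻ x in halfOpenCube c h, g x = ∫⁻ x in cube c h, g x :=
    setLIntegral_congr (halfOpenCube_ae_eq_cube c hh.le)
  have hgfin : ∫⁻ x in halfOpenCube c h, g x ≠ ∞ := hgQ ▸ hfin c h hh
  have hQm := measurableSet_halfOpenCube c h
  have : IsFiniteMeasure (volume.restrict (halfOpenCube c h)) :=
    ⟨by rw [Measure.restrict_apply_univ, volume_halfOpenCube]; finiteness⟩
  have hAtop : eAvg v c h ≠ ∞ := ENNReal.div_ne_top (hfin c h hh) (volume_cube_ne_zero c hh)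
  have hA0 : ∀ᵐ x ∂volume.restrict (halfOpenCube c h),
      cellAvg (volume.restrict (halfOpenCube c h)) (dyadicIndex c h) g 0 x = eAvg v c h := by
    filter_upwards [ae_restrict_mem hQm] with x hx
    have hc : c ∈ halfOpenCube c h := halfOpenCube_eq_cell c hh ▸ mem_cell_self _ _ _
    rw [cellAvg_eq_of_mem (halfOpenCube_eq_cell c hh ▸ hx : x ∈ cell (dyadicIndex c h) 0 c),
      hg, cellAvg_dyadicIndex v hh hc, dyadicCenter_zero_self c hh, pow_zero, div_one]
  have hFW : ∀ j x, ∫⁻ y in cell (dyadicIndex c h) j x, (⨆ i ≥ j,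
      cellAvg (volume.restrict (halfOpenCube c h)) (dyadicIndex c h) g i y)
        ∂volume.restrict (halfOpenCube c h)
      ≤ B * ∫⁻ y in cell (dyadicIndex c h) j x, g y ∂volume.restrict (halfOpenCube c h) := by
    intro j x
    by_cases hx : x ∈ halfOpenCube c h
    · set P := cube (dyadicCenter c h j x) (h / 2 ^ j) with hP
      have hr : 0 < h / 2 ^ j := by positivity
      have hcellP : cell (dyadicIndex c h) j x ⊆ P := by
        rw [cell_dyadicIndex c hh]
        exact halfOpenCube_subset_cube _ _
      calc _ ≤ ∫⁻ y in cell (dyadicIndex c h) j x, hlMax (P.indicator v) y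
            ∂volume.restrict (halfOpenCube c h) := by
            refine setLIntegral_mono' (measurableSet_cell_dyadicIndex c h j x) fun y hy => ?_
            have hyQ := cell_dyadicIndex_subset hh hx j hy
            refine iSup₂_le fun i hi => ?_
            rw [hg, cellAvg_dyadicIndex v hh hyQ]
            refine eAvg_le_hlMax v (by positivity) (mem_cube_dyadicCenter hh i y) ?_
            rw [← cell_dyadicIndex c hh]
            refine ((nestedCells_dyadicIndex c h).cell_subset hi y).trans ?_
            rwa [cell_eq_of_mem hy]
        _ = ∫⁻ y in P, hlMax (P.indicator v) y := by rw [restrict_restrict_cell hh hx]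
        _ ≤ bConst n v * ∫⁻ y in P, g y :=
            setLIntegral_hlMax_le hpos hr (hfin _ _ hr) hvm
        _ ≤ B * ∫⁻ y in P, g y := by gcongr
        _ = _ := by rw [restrict_restrict_cell hh hx]
    · rw [setLIntegral_measure_zero _ _ (restrict_cell_eq_zero hh hx j)]
      exact zero_le
  have hlim : ∀ᵐ x ∂volume.restrict (halfOpenCube c h), Tendsto (fun k =>
      cellAvg (volume.restrict (halfOpenCube c h)) (dyadicIndex c h) g k x) atTop (𝓝 (g x)) := by
    rw [ae_restrict_iff' hQm]
    have hLeb := ae_tendsto_setLIntegral_cube_div (f := (halfOpenCube c h).indicator g)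
      (hgm.indicator hQm) (by rwa [lintegral_indicator hQm])
    filter_upwards [hLeb] with x hx hxQ
    have hr : Tendsto (fun k : ℕ => h / 2 ^ k) atTop (𝓝[>] 0) := by
      refine tendsto_nhdsWithin_iff.2 ⟨?_, Eventually.of_forall fun k => by
        simp only [mem_Ioi]; positivity⟩
      exact tendsto_const_nhds.div_atTop (tendsto_pow_atTop_atTop_of_one_lt one_lt_two)
    have h1 := hx (fun k => dyadicCenter c h k x) _ hr fun k => mem_cube_dyadicCenter hh k x
    rw [indicator_of_mem hxQ] at h1
    refine h1.congr fun k => ?_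
    rw [cellAvg, restrict_cell_eq_volume_cube hh hxQ, ← restrict_restrict_cell hh hxQ]
    congr 1
    refine setLIntegral_congr_fun (measurableSet_cell_dyadicIndex c h k x) fun y hy => ?_
    exact indicator_of_mem (cell_dyadicIndex_subset hh hxQ k hy) g
  have main := lintegral_rpow_one_add_le_of_cells (measurable_dyadicIndex c h)
    (nestedCells_dyadicIndex c h) (one_le_pow₀ one_le_two : (1 : ℝ≥0) ≤ 2 ^ n)
    (restrict_cell_le hh) hε0 hε hBε hgm.restrict hgfin hAtop hA0 hFW hlim
  rw [hgQ, setLIntegral_congr (halfOpenCube_ae_eq_cube c hh.le)] at main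
  have hpow : ∫⁻ x in cube c h, ENNReal.ofReal (v x ^ (1 + ε : ℝ))
      = ∫⁻ x in cube c h, g x ^ (1 + ε : ℝ) := by
    refine lintegral_congr_ae (ae_restrict_of_ae ?_)
    filter_upwards [hpos] with x hx
    rw [ENNReal.ofReal_rpow_of_pos hx]
  rw [eAvg, hpow]
  refine (ENNReal.div_le_div_right main _).trans (le_of_eq ?_)
  rw [ENNReal.rpow_add_of_nonneg (1 : ℝ) (ε : ℝ) zero_le_one ε.coe_nonneg, ENNReal.rpow_one]
  rw [mul_div_assoc, mul_div_assoc, mul_comm (eAvg v c h) (eAvg v c h ^ (ε : ℝ))]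
  rfl

theorem IsWeight.aemeasurable {n : ℕ} {w : Euc n → ℝ} (hw : IsWeight w) : AEMeasurable w :=
  hw.1.aestronglyMeasurable.aemeasurable

theorem isCompact_cube {n : ℕ} (c : Euc n) {h : ℝ} (hh : 0 ≤ h) : IsCompact (cube c h) := by
  rw [cube_eq_preimage_closedBall c hh]
  exact (PiLp.homeomorph 2 fun _ : Fin n => ℝ).isCompact_preimage.2 (isCompact_closedBall _ _)

theorem IsWeight.setLIntegral_ne_top {n : ℕ} {w : Euc n → ℝ} (hw : IsWeight w) (c : Euc n) {h : ℝ}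
    (hh : 0 < h) : ∫⁻ x in cube c h, ENNReal.ofReal (w x) ≠ ∞ :=
  (hw.1.integrableOn_isCompact (isCompact_cube c hh.le)).lintegral_lt_top.ne

theorem apRatio_le_apConst {n : ℕ} (p : ℝ) (w : Euc n → ℝ) (c : Euc n) {h : ℝ} (hh : 0 < h) :
    apRatio p w c h ≤ apConst n p w :=
  le_iSup_of_le c (le_iSup_of_le h (le_iSup_of_le hh le_rfl))

theorem IsWeight.setLIntegral_dual_ne_top {n : ℕ} {p : ℝ} (hp : 1 < p) {w : Euc n → ℝ}
    (hw : IsWeight w) (hA : apConst n p w < ∞) (c : Euc n) {h : ℝ} (hh : 0 < h) :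
    ∫⁻ x in cube c h, ENNReal.ofReal (w x ^ (1 - conjExp p)) ≠ ∞ := by
  have h1 : apRatio p w c h ≠ ∞ := ((apRatio_le_apConst p w c hh).trans_lt hA).ne
  have h2 : eAvg w c h ≠ 0 :=
    (ENNReal.div_pos (setLIntegral_ofReal_ne_zero hw.2 hw.aemeasurable hh)
      (volume_cube_ne_top c hh.le)).ne'
  intro htop
  refine h1 ?_
  have h3 : eAvg (fun x => w x ^ (1 - conjExp p)) c h = ∞ := by
    rw [eAvg, htop, ENNReal.top_div_of_ne_top (volume_cube_ne_top c hh.le)]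
  rw [apRatio, h3, ENNReal.top_rpow_of_pos (by linarith), ENNReal.mul_top h2]

/-- If `w` and its dual weight satisfy a reverse Hölder inequality with constant `D`, then so does
the `A_p` constant, with constant `D ^ p`. -/
theorem apConst_rpow_le {n : ℕ} {p : ℝ} (hp : 1 < p) {w : Euc n → ℝ} (hpos : ∀ᵐ x, 0 < w x)
    {D : ℝ≥0∞} {q : ℝ} (hq : 0 ≤ q)
    (h1 : ∀ (c : Euc n) (h : ℝ), 0 < h → eAvg (fun x => w x ^ q) c h ≤ D * eAvg w c h ^ q)
    (h2 : ∀ (c : Euc n) (h : ℝ), 0 < h → eAvg (fun x => (w x ^ (1 - conjExp p)) ^ q) c h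
      ≤ D * eAvg (fun x => w x ^ (1 - conjExp p)) c h ^ q) :
    apConst n p (fun x => w x ^ q) ≤ D ^ p * apConst n p w ^ q := by
  refine iSup_le fun c => iSup_le fun h => iSup_le fun hh => ?_
  have hp1 : 0 ≤ p - 1 := by linarith
  have hdual : eAvg (fun x => (w x ^ q) ^ (1 - conjExp p)) c h
      = eAvg (fun x => (w x ^ (1 - conjExp p)) ^ q) c h := by
    rw [eAvg, eAvg]
    congr 1
    refine lintegral_congr_ae (ae_restrict_of_ae ?_)
    filter_upwards [hpos] with x hx
    rw [← Real.rpow_mul hx.le, ← Real.rpow_mul hx.le, mul_comm]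
  set S := eAvg (fun x => w x ^ (1 - conjExp p)) c h with hS
  calc apRatio p (fun x => w x ^ q) c h
      ≤ (D * eAvg w c h ^ q) * (D * S ^ q) ^ (p - 1) := by
        rw [apRatio, hdual]
        exact mul_le_mul' (h1 c h hh) (ENNReal.rpow_le_rpow (h2 c h hh) hp1)
    _ = D ^ p * apRatio p w c h ^ q := by
        rw [apRatio, ENNReal.mul_rpow_of_nonneg _ _ hp1, ENNReal.mul_rpow_of_nonneg _ _ hq,
          ← ENNReal.rpow_mul, ← ENNReal.rpow_mul, mul_comm q (p - 1)]
        have hD : D ^ p = D * D ^ (p - 1) := by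
          nth_rw 2 [← ENNReal.rpow_one D]
          rw [← ENNReal.rpow_add_of_nonneg _ _ zero_le_one hp1, add_sub_cancel]
        rw [hD]
        ring
    _ ≤ D ^ p * apConst n p w ^ q := by
        gcongr
        exact apRatio_le_apConst p w c hh

/-- Hytönen–Pérez–Rela, reverse Hölder inequality for the `A_p` constant.
For `1 < p < ∞` there is `c > 0` depending only on `n` and `p` such that for every `ω ∈ A_p`,
with `δ = c / (ω)_{A_p}` where `(ω)_{A_p} = max([ω]_{B_∞}, [ω^{1-p'}]_{B_∞})`, one has
`ω^{1+δ} ∈ A_p` and `[ω^{1+δ}]_{A_p} ≤ 4 [ω]_{A_p}^{1+δ}`. -/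
theorem reverse_holder_Ap_constant (n : ℕ) (p : ℝ) (hp : 1 < p) :
    ∃ c : ℝ, 0 < c ∧
      ∀ w : Euc n → ℝ, IsWeight w → apConst n p w < ⊤ →
        ∀ δ : ℝ,
          δ = c / (max (bConst n w) (bConst n (fun x => w x ^ (1 - conjExp p)))).toReal →
          apConst n p (fun x => w x ^ (1 + δ)) < ⊤ ∧
            apConst n p (fun x => w x ^ (1 + δ)) ≤ 4 * (apConst n p w) ^ (1 + δ) := by
  have h4 : (1 : ℝ) < 4 ^ (1 / p) := Real.one_lt_rpow (by norm_num) (by positivity)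
  refine ⟨min 1 (4 ^ (1 / p) - 1) / 2 ^ (n + 1),
    div_pos (lt_min one_pos (by linarith)) (by positivity), ?_⟩
  intro w hw hA δ hδ
  set σ : Euc n → ℝ := fun x => w x ^ (1 - conjExp p) with hσ
  set Bmax := max (bConst n w) (bConst n σ) with hBmax
  suffices hle : apConst n p (fun x => w x ^ (1 + δ)) ≤ 4 * apConst n p w ^ (1 + δ) by
    refine ⟨hle.trans_lt (ENNReal.mul_lt_top (by norm_num)
      (ENNReal.rpow_lt_top_of_nonneg ?_ hA.ne)), hle⟩
    have : 0 ≤ δ := hδ ▸ div_nonneg (div_nonneg (le_min zero_le_one (by linarith))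
      (by positivity)) ENNReal.toReal_nonneg
    linarith
  rcases eq_or_ne Bmax ∞ with htop | htop
  · have hδ0 : δ = 0 := by rw [hδ, htop]; simp
    simp only [hδ0, add_zero, Real.rpow_one, ENNReal.rpow_one]
    exact le_mul_of_one_le_left' (by norm_num)
  have hB1 : 1 ≤ Bmax.toReal := by
    rw [← ENNReal.toReal_one]
    refine ENNReal.toReal_mono htop (le_max_of_le_left ?_)
    exact one_le_bConst hw.2 (hw.setLIntegral_ne_top 0 one_pos) hw.aemeasurable
  have hB0 : 0 < Bmax.toReal := by linarith
  set m : ℝ := min 1 (4 ^ (1 / p) - 1) with hm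
  have hm0 : 0 < m := lt_min one_pos (by linarith)
  have hm1 : m ≤ 1 := min_le_left _ _
  have hδ0 : 0 < δ := hδ ▸ by positivity
  have hBδ : 2 * (Bmax.toReal * 2 ^ n * δ) = m := by
    rw [hδ, pow_succ]
    field_simp
  have hδ1 : δ ≤ 1 := by
    have h1 : 1 ≤ Bmax.toReal * 2 ^ n := one_le_mul_of_one_le_of_one_le hB1 (one_le_pow₀ one_le_two)
    have h2 : 1 * δ ≤ Bmax.toReal * 2 ^ n * δ := by gcongr
    linarith
  lift δ to ℝ≥0 using hδ0.le
  have hBε : ((2 * (Bmax.toNNReal * 2 ^ n * δ) : ℝ≥0) : ℝ) = m := by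
    rw [← hBδ]
    push_cast
    rfl
  have hBε1 : 2 * (Bmax.toNNReal * 2 ^ n * δ) ≤ 1 := by
    rw [← NNReal.coe_le_coe, hBε]
    exact hm1
  have hD : ((1 + 2 * (Bmax.toNNReal * 2 ^ n * δ) : ℝ≥0) : ℝ≥0∞) ^ p ≤ 4 := by
    rw [← ENNReal.coe_rpow_of_nonneg _ (by linarith)]
    have hreal : ((1 + 2 * (Bmax.toNNReal * 2 ^ n * δ) : ℝ≥0) : ℝ) ^ p ≤ 4 := by
      rw [NNReal.coe_add, hBε, NNReal.coe_one]
      calc (1 + m) ^ p ≤ ((4 : ℝ) ^ (1 / p)) ^ p := by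
            gcongr
            linarith [min_le_right (1 : ℝ) (4 ^ (1 / p) - 1)]
        _ = 4 := by
            rw [← Real.rpow_mul (by norm_num), one_div_mul_cancel (by linarith), Real.rpow_one]
    exact_mod_cast hreal
  have hBle : bConst n w ≤ Bmax.toNNReal ∧ bConst n σ ≤ Bmax.toNNReal := by
    rw [ENNReal.coe_toNNReal htop]
    exact ⟨le_max_left _ _, le_max_right _ _⟩
  have hδpos : 0 < δ := by exact_mod_cast hδ0
  have hδone : δ ≤ 1 := by exact_mod_cast hδ1
  have hσpos : ∀ᵐ x, 0 < σ x := hw.2.mono fun x hx => Real.rpow_pos_of_pos hx _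
  refine (apConst_rpow_le hp hw.2 (by positivity)
    (fun c h hh => eAvg_rpow_one_add_le hw.aemeasurable hw.2
      (fun c h hh => hw.setLIntegral_ne_top c hh) hBle.1 hδpos hδone hBε1 c hh)
    (fun c h hh => eAvg_rpow_one_add_le (hw.aemeasurable.pow_const _) hσpos
      (fun c h hh => hw.setLIntegral_dual_ne_top hp hA c hh) hBle.2 hδpos hδone hBε1 c hh)).trans ?_
  gcongr
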